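/- For any function h : X → ℝ, any policy μ : X → U, and any initial state x₀, the liminf average cost satisfies liminf_{T→∞} (1/(T+1)) Σ_{t=0}^{T} E[r(X(t), μ(X(t)))] ≥ min_{x ∈ X, u ∈ U} ( r(x, u) + Σ_{y ∈ X} P(x, u)(y) · h(y) − h(x) ). -/

import Mathlib

open Filter Finset

/-- Distribution of the chain after `t` steps under kernel `K`, started at `x₀`:
the `t`-fold monadic bind of `K` applied to the point mass at `x₀`. -/
noncomputable def chainDist {X : Type*} (K : X → PMF X) (x₀ : X) : ℕ → PMF X
  | 0 => PMF.pure x₀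
  | t + 1 => (chainDist K x₀ t).bind K

/-- Expectation of `f` under a PMF on a finite type. -/
noncomputable def pmfExp {X : Type*} [Fintype X] (q : PMF X) (f : X → ℝ) : ℝ :=
  ∑ x, (q x).toReal * f x

/-- The average cost over periods `0,…,T` of running the Markov chain with step
kernel `K` and per-stage cost `c`, started at `x₀`. -/
noncomputable def avgCost {X : Type*} [Fintype X] (K : X → PMF X) (c : X → ℝ)
    (x₀ : X) (T : ℕ) : ℝ :=
  (1 / (T + 1 : ℝ)) * ∑ t ∈ Finset.range (T + 1), pmfExp (chainDist K x₀ t) c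

section PmfExp

variable {X : Type*} [Fintype X]

theorem pmfExp_const (q : PMF X) (a : ℝ) : pmfExp q (fun _ => a) = a := by
  have hq : ∑ x, (q x).toReal = 1 := by
    rw [← ENNReal.toReal_sum fun x _ => q.apply_ne_top x, ← tsum_fintype (L := .unconditional X),
      q.tsum_coe, ENNReal.toReal_one]
  rw [pmfExp, ← Finset.sum_mul, hq, one_mul]

theorem pmfExp_mono (q : PMF X) {f g : X → ℝ} (hfg : ∀ x, f x ≤ g x) :
    pmfExp q f ≤ pmfExp q g :=
  Finset.sum_le_sum fun x _ => mul_le_mul_of_nonneg_left (hfg x) ENNReal.toReal_nonneg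

theorem pmfExp_add (q : PMF X) (f g : X → ℝ) :
    pmfExp q (fun x => f x + g x) = pmfExp q f + pmfExp q g := by
  simp only [pmfExp, mul_add, Finset.sum_add_distrib]

theorem pmfExp_bind (q : PMF X) (K : X → PMF X) (f : X → ℝ) :
    pmfExp (q.bind K) f = pmfExp q (fun x => pmfExp (K x) f) := by
  have hbind (y : X) : (q.bind K y).toReal = ∑ x, (q x).toReal * (K x y).toReal := by
    rw [PMF.bind_apply, tsum_fintype, ENNReal.toReal_sum fun x _ =>
      ENNReal.mul_ne_top (q.apply_ne_top x) ((K x).apply_ne_top y)]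
    simp only [ENNReal.toReal_mul]
  simp only [pmfExp, hbind, Finset.sum_mul, Finset.mul_sum]
  rw [Finset.sum_comm]
  simp only [mul_assoc]

/-- Telescoped drift inequality along the chain. -/
theorem mul_le_sum_pmfExp_chainDist_add (K : X → PMF X) (c h : X → ℝ) (x₀ : X) {m : ℝ}
    (hm : ∀ x, m + h x ≤ c x + pmfExp (K x) h) (n : ℕ) :
    n * m + pmfExp (chainDist K x₀ 0) h ≤
      ∑ t ∈ Finset.range n, pmfExp (chainDist K x₀ t) c + pmfExp (chainDist K x₀ n) h := by
  induction n with
  | zero => simp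
  | succ n ih =>
    have hstep := pmfExp_mono (chainDist K x₀ n) hm
    rw [pmfExp_add, pmfExp_add, pmfExp_const, ← pmfExp_bind] at hstep
    rw [Finset.sum_range_succ, chainDist.eq_2]
    push_cast
    linarith

theorem avgCost_le (K : X → PMF X) (c : X → ℝ) (x₀ : X) {M : ℝ} (hM : ∀ x, c x ≤ M) (T : ℕ) :
    avgCost K c x₀ T ≤ M := by
  have hT : (0 : ℝ) < T + 1 := by positivity
  have hsum : ∑ t ∈ Finset.range (T + 1), pmfExp (chainDist K x₀ t) c ≤
      ∑ _t ∈ Finset.range (T + 1), M :=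
    Finset.sum_le_sum fun t _ => (pmfExp_mono _ hM).trans_eq (pmfExp_const _ M)
  rw [Finset.sum_const, Finset.card_range, nsmul_eq_mul] at hsum
  rw [avgCost, one_div, inv_mul_le_iff₀ hT]
  exact_mod_cast hsum

theorem le_avgCost_of_drift (K : X → PMF X) (c h : X → ℝ) (x₀ : X) {m B : ℝ}
    (hm : ∀ x, m + h x ≤ c x + pmfExp (K x) h) (hB : ∀ x, |h x| ≤ B) (T : ℕ) :
    m - 2 * B * (1 / ((T : ℝ) + 1)) ≤ avgCost K c x₀ T := by
  have hT : (0 : ℝ) < T + 1 := by positivity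
  have hsum := mul_le_sum_pmfExp_chainDist_add K c h x₀ hm (T + 1)
  have hlower := pmfExp_mono (chainDist K x₀ 0) fun x => (abs_le.mp (hB x)).1
  have hupper := pmfExp_mono (chainDist K x₀ (T + 1)) fun x => (abs_le.mp (hB x)).2
  rw [pmfExp_const] at hlower hupper
  push_cast at hsum
  rw [avgCost, one_div, le_inv_mul_iff₀ hT]
  have hcancel : ((T : ℝ) + 1) * (m - 2 * B * ((T : ℝ) + 1)⁻¹) = (T + 1) * m - 2 * B := by
    field_simp
  linarith

theorem le_liminf_avgCost_of_drift (K : X → PMF X) (c h : X → ℝ) (x₀ : X) {m : ℝ}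
    (hm : ∀ x, m + h x ≤ c x + pmfExp (K x) h) :
    m ≤ liminf (avgCost K c x₀) atTop := by
  obtain ⟨B, hB⟩ := (Set.finite_range fun x => |h x|).bddAbove
  obtain ⟨M, hM⟩ := (Set.finite_range c).bddAbove
  have hlim : Tendsto (fun T : ℕ => m - 2 * B * (1 / ((T : ℝ) + 1))) atTop (nhds m) := by
    simpa using (tendsto_one_div_add_atTop_nhds_zero_nat (𝕜 := ℝ)).const_mul (2 * B)
      |>.const_sub m
  have hbdd : IsBoundedUnder (· ≤ ·) atTop (avgCost K c x₀) :=
    isBoundedUnder_of ⟨M, avgCost_le K c x₀ fun x => hM ⟨x, rfl⟩⟩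
  rw [← hlim.liminf_eq]
  exact liminf_le_liminf
    (Eventually.of_forall (le_avgCost_of_drift K c h x₀ hm fun x => hB ⟨x, rfl⟩))
    hlim.isBoundedUnder_ge hbdd.isCoboundedUnder_ge

end PmfExp

theorem liminf_avg_cost_ge_min_cost_plus_drift
    {X U : Type*} [Fintype X] [Nonempty X] [Fintype U] [Nonempty U]
    {X U : Type*} [Fintype X] [Nonempty X] [Fintype U] [Nonempty U]
    (r : X → U → ℝ) (P : X → U → PMF X) (h : X → ℝ) (μ : X → U) (x₀ : X) :
    liminf (avgCost (fun x => P x (μ x)) (fun x => r x (μ x)) x₀) atTop ≥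
      Finset.univ.inf' Finset.univ_nonempty
        (fun xu : X × U => r xu.1 xu.2 + (∑ y, ((P xu.1 xu.2) y).toReal * h y) - h xu.1) := by
  refine le_liminf_avgCost_of_drift _ _ h x₀ fun x => ?_
  have hx := Finset.inf'_le
    (fun xu : X × U => r xu.1 xu.2 + (∑ y, ((P xu.1 xu.2) y).toReal * h y) - h xu.1)
    (Finset.mem_univ (x, μ x))
  simpa only [pmfExp] using le_sub_iff_add_le.mp hx
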